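/- Let d = ℓ + m, p ≥ 1, and consider the multivariate unified skew-normal density f_{SUN_{d,p}}(x; ξ, γ, ω, Ω*) = φ_d(x − ξ; Ω) · Φ_p(γ + Δᵗ Ω̄⁻¹ ω⁻¹ (x − ξ); Γ − Δᵗ Ω̄⁻¹ Δ) / Φ_p(γ; Γ), with ξ = (ξ₁, ξ₂) ∈ ℝ^ℓ × ℝ^m, ω = diag(ω₁, …, ω_d) with positive entries, Ω = ωΩ̄ω, and Ω* = [[Γ, Δᵗ], [Δ, Ω̄]] positive definite with Ω̄ a correlation matrix. Partition Ω̄ and Δ conformally with the split d = ℓ + m, writing Ω̄₂₂ ∈ ℝ^{m×m} for the lower-right block of Ω̄ and Δ₂ ∈ ℝ^{m×p} for the corresponding block of Δ, and let ω₂ = diag(ω_{ℓ+1}, …, ω_d). Then for every x₂ ∈ ℝ^m, ∫_{ℝ^ℓ} f_{SUN_{d,p}}((x₁, x₂); ξ, γ, ω, Ω*) dx₁ = f_{SUN_{m,p}}(x₂; ξ₂, γ, ω₂, Ω*₂), where Ω*₂ = [[Γ, Δ₂ᵗ], [Δ₂, Ω̄₂₂]]. That is, the marginal of a SUN_{d,p}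 distribution over a block of coordinates is again a unified skew-normal distribution SUN_{m,p} with the stated parameters. -/

import Mathlib

open MeasureTheory Matrix

/-- Multivariate Gaussian density `φ(x; μ, Σ)` on `ι → ℝ`. -/
noncomputable def gaussPdf {ι : Type*} [Fintype ι] [DecidableEq ι]
    (μ : ι → ℝ) (S : Matrix ι ι ℝ) (x : ι → ℝ) : ℝ :=
  (2 * Real.pi) ^ (-(Fintype.card ι : ℝ) / 2) * S.det ^ (-(1 : ℝ) / 2) *
    Real.exp (-(1 / 2) * ((x - μ) ⬝ᵥ S⁻¹ *ᵥ (x - μ)))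

/-- Centered multivariate Gaussian cumulative distribution function `Φ(t; Σ)`. -/
noncomputable def gaussCdf {ι : Type*} [Fintype ι] [DecidableEq ι]
    (S : Matrix ι ι ℝ) (t : ι → ℝ) : ℝ :=
  ∫ x in Set.Iic t, gaussPdf 0 S x

/-- Density of the multivariate unified skew-normal distribution
`SUN(ξ, γ, ω1, Ω* = [[Γ, Δᵀ], [Δ, Ω̄]])`, with `ω = diagonal w` and `Ω = ωΩ̄ω`. -/
noncomputable def sunPdf {ι κ : Type*} [Fintype ι] [Fintype κ] [DecidableEq ι] [DecidableEq κ]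
    (ξ : ι → ℝ) (γ : κ → ℝ) (w : ι → ℝ) (Γ : Matrix κ κ ℝ) (Δ : Matrix ι κ ℝ)
    (Ωb : Matrix ι ι ℝ) (x : ι → ℝ) : ℝ :=
  gaussPdf 0 (Matrix.diagonal w * Ωb * Matrix.diagonal w) (x - ξ) *
      gaussCdf (Γ - Δᵀ * Ωb⁻¹ * Δ) (γ + Δᵀ *ᵥ Ωb⁻¹ *ᵥ fun i => (x i - ξ i) / w i) /
    gaussCdf Γ γ

section Gaussian

theorem integrable_exp_neg_half_dotProduct {ι : Type*} [Fintype ι] :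
    Integrable fun x : ι → ℝ => Real.exp (-(1 / 2) * (x ⬝ᵥ x)) := by
  have h := Integrable.fintype_prod (ι := ι) (μ := fun _ => (volume : Measure ℝ))
    (fun _ => integrable_exp_neg_mul_sq (b := 1 / 2) (by norm_num))
  simp only [← Real.exp_sum, ← Finset.mul_sum] at h
  simp only [dotProduct, ← pow_two]
  exact h

theorem integral_exp_neg_half_dotProduct {ι : Type*} [Fintype ι] :
    ∫ x : ι → ℝ, Real.exp (-(1 / 2) * (x ⬝ᵥ x)) = (2 * Real.pi) ^ ((Fintype.card ι : ℝ) / 2) := by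
  have h := integral_fintype_prod_volume_eq_pow (ι := ι)
    (fun x : ℝ => Real.exp (-(1 / 2) * x ^ 2))
  simp only [← Real.exp_sum, ← Finset.mul_sum] at h
  simp only [dotProduct, ← pow_two]
  rw [h, integral_gaussian, Real.sqrt_eq_rpow, ← Real.rpow_natCast,
    ← Real.rpow_mul (by positivity)]
  congr 1 <;> ring

variable {ι κ τ : Type*} [Fintype ι] [DecidableEq ι] [Fintype κ] [DecidableEq κ]
  [Fintype τ] [DecidableEq τ]

theorem gaussPdf_zero_neg (S : Matrix ι ι ℝ) (x : ι → ℝ) :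
    gaussPdf 0 S (-x) = gaussPdf 0 S x := by
  simp [gaussPdf, mulVec_neg]

theorem gaussPdf_nonneg {S : Matrix ι ι ℝ} (hS : S.PosDef) (μ x : ι → ℝ) :
    0 ≤ gaussPdf μ S x := by
  have := hS.det_pos
  unfold gaussPdf
  positivity

theorem continuous_gaussPdf (μ : ι → ℝ) (S : Matrix ι ι ℝ) : Continuous (gaussPdf μ S) := by
  unfold gaussPdf
  fun_prop

theorem gaussPdf_zero_submatrix_equiv (e : κ ≃ ι) (S : Matrix ι ι ℝ) (x : ι → ℝ) :
    gaussPdf 0 (S.submatrix e e) (x ∘ e) = gaussPdf 0 S x := by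
  simp only [gaussPdf, det_submatrix_equiv_self, inv_submatrix_equiv, sub_zero,
    submatrix_mulVec_equiv, Fintype.card_congr e, comp_equiv_dotProduct_comp_equiv,
    Function.comp_assoc, Equiv.self_comp_symm, Function.comp_id]

open scoped MatrixOrder in
theorem Matrix.PosDef.exists_inv_eq_transpose_mul_self {S : Matrix ι ι ℝ} (hS : S.PosDef) :
    ∃ B : Matrix ι ι ℝ, S⁻¹ = Bᵀ * B := by
  obtain ⟨B, hB⟩ := CStarAlgebra.nonneg_iff_eq_star_mul_self.mp hS.inv.posSemidef.nonneg
  exact ⟨B, by simpa [star_eq_conjTranspose] using hB⟩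

theorem integrable_integral_gaussPdf {S : Matrix ι ι ℝ} (hS : S.PosDef) :
    Integrable (gaussPdf 0 S) ∧ ∫ x, gaussPdf 0 S x = 1 := by
  obtain ⟨B, hB⟩ := hS.exists_inv_eq_transpose_mul_self
  have hdet : S.det⁻¹ = |B.det| ^ 2 := by
    rw [sq_abs, ← Ring.inverse_eq_inv', ← det_nonsing_inv, hB, det_mul, det_transpose, pow_two]
  have hSpos := hS.det_pos
  have hB0 : B.det ≠ 0 := by
    intro h
    rw [h] at hdet
    simp at hdet
    exact hSpos.ne' hdet
  have hcoef : S.det ^ (-(1 : ℝ) / 2) = |B.det| := by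
    rw [neg_div, Real.rpow_neg hSpos.le, ← Real.inv_rpow hSpos.le, hdet, ← Real.rpow_natCast,
      ← Real.rpow_mul (abs_nonneg _)]
    norm_num
  have hpdf : gaussPdf 0 S = fun x => (2 * Real.pi) ^ (-(Fintype.card ι : ℝ) / 2) * |B.det| *
      (fun y : ι → ℝ => Real.exp (-(1 / 2) * (y ⬝ᵥ y))) (toLin' B x) := by
    ext x
    simp only [gaussPdf, hcoef, hB, sub_zero, toLin'_apply, dotProduct_mulVec, ← vecMul_vecMul,
      vecMul_transpose]
  have hmap := Real.map_matrix_volume_pi_eq_smul_volume_pi hB0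
  have hmeas : AEMeasurable (toLin' B) volume :=
    (LinearMap.continuous_of_finiteDimensional _).aemeasurable
  have hcont : Continuous fun y : ι → ℝ => Real.exp (-(1 / 2) * (y ⬝ᵥ y)) := by fun_prop
  have hint : Integrable (fun y : ι → ℝ => Real.exp (-(1 / 2) * (y ⬝ᵥ y)))
      (Measure.map (toLin' B) volume) := by
    rw [hmap]
    exact integrable_exp_neg_half_dotProduct.smul_measure ENNReal.ofReal_ne_top
  constructor
  · rw [hpdf]
    exact (hint.comp_aemeasurable hmeas).const_mul _
  · rw [hpdf, integral_const_mul, ← integral_map hmeas hcont.aestronglyMeasurable, hmap,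
      integral_smul_measure, integral_exp_neg_half_dotProduct, ENNReal.toReal_ofReal (abs_nonneg _),
      abs_inv, smul_eq_mul, neg_div, Real.rpow_neg (by positivity)]
    have : (2 * Real.pi) ^ ((Fintype.card ι : ℝ) / 2) ≠ 0 := by positivity
    field_simp

theorem Matrix.PosDef.schur_complement₂₂ {A : Matrix ι ι ℝ} {B : Matrix ι κ ℝ} {C : Matrix κ ι ℝ}
    {D : Matrix κ κ ℝ} (h : (fromBlocks A B C D).PosDef) : (A - B * D⁻¹ * C).PosDef := by
  have hD : D.PosDef := h.submatrix Sum.inr_injective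
  obtain rfl : Bᴴ = C := (isHermitian_fromBlocks_iff.mp h.isHermitian).2.1
  let _ := hD.isUnit.invertible
  have hdet := h.det_pos
  rw [det_fromBlocks₂₂, invOf_eq_nonsing_inv] at hdet
  exact (((PosDef.fromBlocks₂₂ A B hD).mp h.posSemidef).posDef_iff_det_ne_zero).mpr
    (right_ne_zero_of_mul hdet.ne')

theorem gaussPdf_zero_fromBlocks {A : Matrix ι ι ℝ} {B : Matrix ι κ ℝ} {C : Matrix κ ι ℝ}
    {D : Matrix κ κ ℝ} (h : (fromBlocks A B C D).PosDef) (u : ι → ℝ) (z : κ → ℝ) :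
    gaussPdf 0 (fromBlocks A B C D) (Sum.elim u z) =
      gaussPdf 0 D z * gaussPdf 0 (A - B * D⁻¹ * C) (u - B *ᵥ D⁻¹ *ᵥ z) := by
  have hS := h.schur_complement₂₂
  have hD : D.PosDef := h.submatrix Sum.inr_injective
  have hdet : (fromBlocks A B C D).det = D.det * (A - B * D⁻¹ * C).det := by
    let _ := hD.isUnit.invertible
    rw [det_fromBlocks₂₂, invOf_eq_nonsing_inv]
  have hBC : Cᵀ = B := by
    simpa using (isHermitian_fromBlocks_iff.mp h.isHermitian).2.2.1
  have hDt : D⁻¹ᵀ = D⁻¹ := by simpa using hD.inv.isHermitian.eq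
  have hDu := (isUnit_iff_isUnit_det _).mp hD.isUnit
  have hSu := (isUnit_iff_isUnit_det _).mp hS.isUnit
  have hMu := (isUnit_iff_isUnit_det _).mp h.isUnit
  set S := A - B * D⁻¹ * C with hSdef
  set v := S⁻¹ *ᵥ (u - B *ᵥ D⁻¹ *ᵥ z) with hv
  have hSv : S *ᵥ v = u - B *ᵥ D⁻¹ *ᵥ z := by
    rw [hv, mulVec_mulVec, mul_nonsing_inv _ hSu, one_mulVec]
  have hinv : (fromBlocks A B C D)⁻¹ *ᵥ Sum.elim u z = Sum.elim v (D⁻¹ *ᵥ (z - C *ᵥ v)) := by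
    have hsol : Sum.elim u z = fromBlocks A B C D *ᵥ Sum.elim v (D⁻¹ *ᵥ (z - C *ᵥ v)) := by
      rw [fromBlocks_mulVec]
      simp only [Sum.elim_comp_inl, Sum.elim_comp_inr]
      congr 1
      · rw [hSdef, sub_mulVec, ← mulVec_mulVec, ← mulVec_mulVec] at hSv
        rw [mulVec_sub, mulVec_sub]
        linear_combination -hSv
      · rw [mulVec_mulVec _ D, mul_nonsing_inv _ hDu, one_mulVec, add_sub_cancel]
    rw [hsol, mulVec_mulVec, nonsing_inv_mul _ hMu, one_mulVec]
  have hcross : z ⬝ᵥ D⁻¹ *ᵥ C *ᵥ v = (B *ᵥ D⁻¹ *ᵥ z) ⬝ᵥ v := by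
    rw [dotProduct_mulVec, dotProduct_mulVec, ← mulVec_transpose, ← mulVec_transpose, hBC, hDt]
  have hquad : Sum.elim u z ⬝ᵥ (fromBlocks A B C D)⁻¹ *ᵥ Sum.elim u z =
      z ⬝ᵥ D⁻¹ *ᵥ z + (u - B *ᵥ D⁻¹ *ᵥ z) ⬝ᵥ v := by
    rw [hinv, sumElim_dotProduct_sumElim, mulVec_sub, dotProduct_sub, hcross, sub_dotProduct]
    ring
  simp only [gaussPdf, sub_zero]
  rw [hquad, hdet, Real.mul_rpow hD.det_pos.le hS.det_pos.le, Fintype.card_sum, mul_add,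
    Real.exp_add, Nat.cast_add, neg_add, add_div, Real.rpow_add (by positivity)]
  ring

theorem integrable_integral_gaussPdf_sumElim {M : Matrix (ι ⊕ κ) (ι ⊕ κ) ℝ} (hM : M.PosDef)
    (z : κ → ℝ) :
    Integrable (fun u : ι → ℝ => gaussPdf 0 M (Sum.elim u z)) ∧
      ∫ u : ι → ℝ, gaussPdf 0 M (Sum.elim u z) = gaussPdf 0 M.toBlocks₂₂ z := by
  rw [← fromBlocks_toBlocks M] at hM
  obtain ⟨hint, hone⟩ := integrable_integral_gaussPdf hM.schur_complement₂₂
  nth_rw 1 2 [← fromBlocks_toBlocks M]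
  simp only [gaussPdf_zero_fromBlocks hM]
  refine ⟨(hint.comp_sub_right _).const_mul _, ?_⟩
  rw [integral_const_mul, integral_sub_right_eq_self (gaussPdf 0 _), hone, mul_one]

theorem integrable_prod_gaussPdf_sumElim {M : Matrix (ι ⊕ κ ⊕ τ) (ι ⊕ κ ⊕ τ) ℝ} (hM : M.PosDef)
    (c : τ → ℝ) :
    Integrable (fun q : (ι → ℝ) × (κ → ℝ) => gaussPdf 0 M (Sum.elim q.1 (Sum.elim q.2 c)))
      (volume.prod volume) := by
  have hcont : Continuous fun q : (ι → ℝ) × (κ → ℝ) => Sum.elim q.1 (Sum.elim q.2 c) := by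
    refine continuous_pi ?_
    rintro (i | i | i) <;> simp only [Sum.elim_inl, Sum.elim_inr] <;> fun_prop
  have hM₂ : M.toBlocks₂₂.PosDef := hM.submatrix Sum.inr_injective
  have hmeas := (continuous_gaussPdf 0 M).comp hcont |>.aestronglyMeasurable
    (μ := (volume : Measure (ι → ℝ)).prod (volume : Measure (κ → ℝ)))
  refine (integrable_prod_iff' hmeas).mpr ?_
  simp only [Function.comp_apply]
  refine ⟨.of_forall fun u => (integrable_integral_gaussPdf_sumElim hM _).1, ?_⟩
  simp only [Real.norm_of_nonneg (gaussPdf_nonneg hM _ _),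
    (integrable_integral_gaussPdf_sumElim hM _).2]
  exact (integrable_integral_gaussPdf_sumElim hM₂ c).1

end Gaussian

section UnifiedSkewNormal

variable {ι κ : Type*} [Fintype ι] [Fintype κ] [DecidableEq ι] [DecidableEq κ]

/-- The covariance matrix `[[Γ, (ωΔ)ᵀ], [ωΔ, ωΩ̄ω]]` of the Gaussian vector underlying a unified
skew-normal distribution, with `ω = diagonal w`. -/
noncomputable def sunCov (w : ι → ℝ) (Γ : Matrix κ κ ℝ) (Δ : Matrix ι κ ℝ) (Ωb : Matrix ι ι ℝ) :
    Matrix (κ ⊕ ι) (κ ⊕ ι) ℝ :=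
  fromBlocks Γ (diagonal w * Δ)ᵀ (diagonal w * Δ) (diagonal w * Ωb * diagonal w)

theorem sunCov_posDef {w : ι → ℝ} (hw : ∀ i, w i ≠ 0) {Γ : Matrix κ κ ℝ} {Δ : Matrix ι κ ℝ}
    {Ωb : Matrix ι ι ℝ} (h : (fromBlocks Γ Δᵀ Δ Ωb).PosDef) : (sunCov w Γ Δ Ωb).PosDef := by
  have hW : IsUnit (diagonal (Sum.elim (1 : κ → ℝ) w)) := by
    rw [isUnit_diagonal, Pi.isUnit_iff]
    rintro (i | i) <;> simp [hw]
  have heq : sunCov w Γ Δ Ωb =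
      star (diagonal (Sum.elim 1 w)) * fromBlocks Γ Δᵀ Δ Ωb * diagonal (Sum.elim 1 w) := by
    ext (i | i) (j | j) <;>
      simp [sunCov, star_eq_conjTranspose, diagonal_mul, mul_diagonal, mul_comm]
  rw [heq]
  exact (IsUnit.posDef_star_left_conjugate_iff hW).mpr h

theorem sunPdf_eq_setIntegral_div {w : ι → ℝ} (hw : ∀ i, w i ≠ 0) {Γ : Matrix κ κ ℝ}
    {Δ : Matrix ι κ ℝ} {Ωb : Matrix ι ι ℝ} (h : (fromBlocks Γ Δᵀ Δ Ωb).PosDef)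
    (ξ : ι → ℝ) (γ : κ → ℝ) (x : ι → ℝ) :
    sunPdf ξ γ w Γ Δ Ωb x =
      (∫ u in Set.Iic γ, gaussPdf 0 (sunCov w Γ Δ Ωb) (Sum.elim u (ξ - x))) / gaussCdf Γ γ := by
  have hW : IsUnit (diagonal w).det := by
    rw [det_diagonal, isUnit_iff_ne_zero]
    exact Finset.prod_ne_zero_iff.mpr fun i _ => hw i
  have hinv : (diagonal w * Ωb * diagonal w)⁻¹ =
      (diagonal w)⁻¹ * Ωb⁻¹ * (diagonal w)⁻¹ := by
    rw [Matrix.mul_inv_rev, Matrix.mul_inv_rev, Matrix.mul_assoc]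
  have hmul : (diagonal w * Δ)ᵀ * (diagonal w * Ωb * diagonal w)⁻¹ =
      Δᵀ * Ωb⁻¹ * (diagonal w)⁻¹ := by
    rw [hinv, transpose_mul, diagonal_transpose, Matrix.mul_assoc, Matrix.mul_assoc,
      mul_nonsing_inv_cancel_left _ _ hW, Matrix.mul_assoc]
  have hschur : Γ - (diagonal w * Δ)ᵀ * (diagonal w * Ωb * diagonal w)⁻¹ * (diagonal w * Δ) =
      Γ - Δᵀ * Ωb⁻¹ * Δ := by
    rw [hmul, Matrix.mul_assoc, nonsing_inv_mul_cancel_left _ _ hW]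
  have hscale : (fun i => (x i - ξ i) / w i) = (diagonal w)⁻¹ *ᵥ (x - ξ) := by
    have : diagonal w *ᵥ (fun i => (x i - ξ i) / w i) = x - ξ := by
      ext i
      rw [mulVec_diagonal, mul_div_cancel₀ _ (hw i), Pi.sub_apply]
    rw [← this, mulVec_mulVec, nonsing_inv_mul _ hW, one_mulVec]
  set a := Δᵀ *ᵥ Ωb⁻¹ *ᵥ fun i => (x i - ξ i) / w i with ha
  have hmean : (diagonal w * Δ)ᵀ *ᵥ (diagonal w * Ωb * diagonal w)⁻¹ *ᵥ (ξ - x) = -a := by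
    rw [mulVec_mulVec, hmul, ha, hscale, ← neg_sub x ξ, mulVec_neg, mulVec_mulVec, mulVec_mulVec]
  have hshift := (measurePreserving_add_right volume a).setIntegral_preimage_emb
    (measurableEmbedding_addRight a) (gaussPdf 0 (Γ - Δᵀ * Ωb⁻¹ * Δ)) (Set.Iic (γ + a))
  have hpre : (fun u => u + a) ⁻¹' Set.Iic (γ + a) = Set.Iic γ := by
    ext u
    simp
  rw [hpre] at hshift
  have hpd := sunCov_posDef hw h
  simp only [sunPdf, sunCov] at hpd ⊢
  simp only [gaussPdf_zero_fromBlocks hpd, hschur, hmean, sub_neg_eq_add, integral_const_mul,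
    hshift, gaussCdf]
  rw [← neg_sub ξ x, gaussPdf_zero_neg]

end UnifiedSkewNormal

/-- **Marginals of the unified skew-normal distribution.**  Integrating the
`SUN_{d,p}(ξ, γ, ω1, Ω*)` density over the first `ℓ` coordinates (of the split `d = ℓ + m`)
yields the `SUN_{m,p}(ξ₂, γ, ω₂1, Ω*₂)` density, where `Ω*₂ = [[Γ, Δ₂ᵀ], [Δ₂, Ω̄₂₂]]`. -/
theorem stmt_12 {l m p : ℕ}
    (ξ₁ : Fin l → ℝ) (ξ₂ : Fin m → ℝ) (γ : Fin p → ℝ)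
    (w₁ : Fin l → ℝ) (w₂ : Fin m → ℝ) (hw₁ : ∀ i, 0 < w₁ i) (hw₂ : ∀ i, 0 < w₂ i)
    (Γ : Matrix (Fin p) (Fin p) ℝ)
    (Δ₁ : Matrix (Fin l) (Fin p) ℝ) (Δ₂ : Matrix (Fin m) (Fin p) ℝ)
    (Ω11 : Matrix (Fin l) (Fin l) ℝ) (Ω12 : Matrix (Fin l) (Fin m) ℝ)
    (Ω21 : Matrix (Fin m) (Fin l) ℝ) (Ω22 : Matrix (Fin m) (Fin m) ℝ)
    (hpd : (Matrix.fromBlocks Γ (Matrix.fromRows Δ₁ Δ₂)ᵀ (Matrix.fromRows Δ₁ Δ₂)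
        (Matrix.fromBlocks Ω11 Ω12 Ω21 Ω22)).PosDef)
    (hcorr₁ : ∀ i, Ω11 i i = 1) (hcorr₂ : ∀ i, Ω22 i i = 1) :
    ∀ x₂ : Fin m → ℝ,
      (∫ x₁ : Fin l → ℝ,
        sunPdf (Sum.elim ξ₁ ξ₂) γ (Sum.elim w₁ w₂) Γ (Matrix.fromRows Δ₁ Δ₂)
          (Matrix.fromBlocks Ω11 Ω12 Ω21 Ω22) (Sum.elim x₁ x₂)) =
      sunPdf ξ₂ γ w₂ Γ Δ₂ Ω22 x₂ := by
  intro x₂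
  have hw : ∀ i, Sum.elim w₁ w₂ i ≠ 0 := by
    rintro (i | i)
    exacts [(hw₁ i).ne', (hw₂ i).ne']
  have hpd₂ : (fromBlocks Γ Δ₂ᵀ Δ₂ Ω22).PosDef := by
    convert hpd.submatrix (e := Sum.map id Sum.inr)
      (Function.injective_id.sumMap Sum.inr_injective) using 1
    ext (i | i) (j | j) <;> rfl
  have hM := sunCov_posDef hw hpd
  set M := sunCov (Sum.elim w₁ w₂) Γ (fromRows Δ₁ Δ₂) (fromBlocks Ω11 Ω12 Ω21 Ω22) with hMdef
  let e : Fin l ⊕ Fin p ⊕ Fin m ≃ Fin p ⊕ Fin l ⊕ Fin m :=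
    (Equiv.sumAssoc _ _ _).symm.trans
      (((Equiv.sumComm _ _).sumCongr (Equiv.refl _)).trans (Equiv.sumAssoc _ _ _))
  have hN : (M.submatrix e e).PosDef := hM.submatrix e.injective
  have hN₂ : (M.submatrix e e).toBlocks₂₂ = sunCov w₂ Γ Δ₂ Ω22 := by
    ext (i | i) (j | j) <;>
      simp [hMdef, e, sunCov, toBlocks₂₂, diagonal_mul, mul_diagonal]
  have hperm (z : Fin l → ℝ) (u : Fin p → ℝ) (c : Fin m → ℝ) :
      gaussPdf 0 M (Sum.elim u (Sum.elim z c)) =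
        gaussPdf 0 (M.submatrix e e) (Sum.elim z (Sum.elim u c)) := by
    rw [← gaussPdf_zero_submatrix_equiv e M]
    congr 1
    ext (i | i | i) <;> rfl
  have hsub (x₁ : Fin l → ℝ) :
      Sum.elim ξ₁ ξ₂ - Sum.elim x₁ x₂ = Sum.elim (ξ₁ - x₁) (ξ₂ - x₂) := by
    ext (i | i) <;> rfl
  simp only [sunPdf_eq_setIntegral_div hw hpd, sunPdf_eq_setIntegral_div (fun i => (hw₂ i).ne') hpd₂,
    integral_div, hsub, ← hMdef, hperm]
  congr 1
  rw [integral_sub_left_eq_self (fun z => ∫ u in Set.Iic γ,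
    gaussPdf 0 (M.submatrix e e) (Sum.elim z (Sum.elim u (ξ₂ - x₂)))), integral_integral_swap]
  · simp only [(integrable_integral_gaussPdf_sumElim hN _).2, hN₂]
  · exact (integrable_prod_gaussPdf_sumElim hN (ξ₂ - x₂)).mono_measure
      (Measure.prod_mono le_rfl Measure.restrict_le_self)
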